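/- arXiv:2401.17854 — 2 statements merged into one kernel-verified Lean document; each statement's English description precedes it below -/
import Mathlib

section
/- Let x : ℝ → ℝ³ be a C^∞ arclength-parametrized curve, s₀ with κ > 0 near s₀. Set x₁ = x(s₀−2ε), x₂ = x(s₀−ε), x₃ = x(s₀), x₄ = x(s₀+ε). Then, as ε → 0 (ε ≠ 0), tLast(x₁,x₂,x₃) · tMid(x₂,x₃,x₄) = 1 − (1/8)·(κ²τ² + κ'²)·ε⁴ + O(ε⁵), where κ, κ', τ are evaluated at s₀. -/
open scoped RealInnerProductSpace Topology
open Asymptotics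

noncomputable section

abbrev E3 := EuclideanSpace ℝ (Fin 3)

/-- Cross product on `ℝ³`. -/
def cross3 (u v : E3) : E3 :=
  (WithLp.equiv 2 (Fin 3 → ℝ)).symm
    ![u 1 * v 2 - u 2 * v 1, u 2 * v 0 - u 0 * v 2, u 0 * v 1 - u 1 * v 0]

/-- Curvature of an arclength-parametrized curve. -/
def curv (x : ℝ → E3) (s : ℝ) : ℝ := ‖iteratedDeriv 2 x s‖

/-- Torsion of an arclength-parametrized curve (where `curv x s > 0`). -/
def tors (x : ℝ → E3) (s : ℝ) : ℝ :=
  ⟪cross3 (deriv x s) (iteratedDeriv 2 x s), iteratedDeriv 3 x s⟫ / curv x s ^ 2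

/-- Oriented unit tangent vector of the circumcircle of `(a, m, b)` at `a`. -/
def tFirst (a m b : E3) : E3 :=
  (1 / dist m b) • ((dist a b / dist a m) • (m - a) + (dist a m / dist a b) • (a - b))

/-- Oriented unit tangent vector of the circumcircle of `(a, m, b)` at `m`. -/
def tMid (a m b : E3) : E3 :=
  (1 / dist a b) • ((dist a m / dist m b) • (b - m) + (dist m b / dist a m) • (m - a))

/-- Oriented unit tangent vector of the circumcircle of `(a, m, b)` at `b`. -/
def tLast (a m b : E3) : E3 :=
  (1 / dist a m) • ((dist m b / dist a b) • (a - b) + (dist a b / dist m b) • (b - m))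

/-- `f ε = a + ε b + ε² c + O(ε³)` as `ε → 0`, `ε ≠ 0`. -/
def HasQuadExpansion {E : Type*} [NormedAddCommGroup E] [NormedSpace ℝ E]
    (f : ℝ → E) (a b c : E) : Prop :=
  (fun ε : ℝ => f ε - (a + ε • b + ε ^ 2 • c)) =O[𝓝[≠] (0 : ℝ)] fun ε => ε ^ 3

namespace HasQuadExpansion

section NormedSpace

variable {E F G : Type*} [NormedAddCommGroup E] [NormedSpace ℝ E]
  [NormedAddCommGroup F] [NormedSpace ℝ F] [NormedAddCommGroup G] [NormedSpace ℝ G]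
  {f f' : ℝ → E} {a b c a' b' c' : E}

theorem const (a : E) : HasQuadExpansion (fun _ => a) a 0 0 := by
  simpa [HasQuadExpansion] using isBigO_zero _ _

theorem add (h : HasQuadExpansion f a b c) (h' : HasQuadExpansion f' a' b' c') :
    HasQuadExpansion (fun ε => f ε + f' ε) (a + a') (b + b') (c + c') := by
  refine (IsBigO.add h h').congr_left fun ε => ?_
  module

theorem sub (h : HasQuadExpansion f a b c) (h' : HasQuadExpansion f' a' b' c') :
    HasQuadExpansion (fun ε => f ε - f' ε) (a - a') (b - b') (c - c') := by
  refine (IsBigO.sub h h').congr_left fun ε => ?_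
  module

theorem tendsto_quadratic (a b c : E) :
    Filter.Tendsto (fun ε : ℝ => a + ε • b + ε ^ 2 • c) (𝓝[≠] 0) (𝓝 a) := by
  have h : Continuous fun ε : ℝ => a + ε • b + ε ^ 2 • c := by fun_prop
  simpa using (h.tendsto 0).mono_left nhdsWithin_le_nhds

theorem tendsto (h : HasQuadExpansion f a b c) : Filter.Tendsto f (𝓝[≠] 0) (𝓝 a) := by
  have hpow : Filter.Tendsto (fun ε : ℝ => ε ^ 3) (𝓝[≠] 0) (𝓝 0) := by
    simpa using ((continuous_pow (M := ℝ) 3).tendsto 0).mono_left nhdsWithin_le_nhds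
  simpa using (h.trans_tendsto hpow).add (tendsto_quadratic a b c)

theorem bilin (L : E →L[ℝ] F →L[ℝ] G) {g : ℝ → F} {p q r : F}
    (h : HasQuadExpansion f a b c) (hg : HasQuadExpansion g p q r) :
    HasQuadExpansion (fun ε => L (f ε) (g ε)) (L a p) (L a q + L b p)
      (L a r + L b q + L c p) := by
  have h₁ : (fun ε => L (f ε - (a + ε • b + ε ^ 2 • c)) (g ε)) =O[𝓝[≠] (0 : ℝ)]
      fun ε => ε ^ 3 := by
    simpa using (L.isBoundedBilinearMap.isBigO_comp (g := fun ε => f ε - (a + ε • b + ε ^ 2 • c))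
      (h := g)).trans (h.norm_left.mul (hg.tendsto.isBigO_one ℝ).norm_left)
  have h₂ : (fun ε => L (a + ε • b + ε ^ 2 • c) (g ε - (p + ε • q + ε ^ 2 • r)))
      =O[𝓝[≠] (0 : ℝ)] fun ε => ε ^ 3 := by
    simpa using (L.isBoundedBilinearMap.isBigO_comp (g := fun ε : ℝ => a + ε • b + ε ^ 2 • c)
      (h := fun ε => g ε - (p + ε • q + ε ^ 2 • r))).trans
      (((tendsto_quadratic a b c).isBigO_one ℝ).norm_left.mul hg.norm_left)
  have h₃ : (fun ε : ℝ => ε ^ 3 • (L b r + L c q + ε • L c r)) =O[𝓝[≠] (0 : ℝ)]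
      fun ε => ε ^ 3 := by
    have ht := tendsto_quadratic (L b r + L c q) (L c r) 0
    simpa using (isBigO_refl (fun ε : ℝ => ε ^ 3) (𝓝[≠] 0)).smul (ht.isBigO_one ℝ)
  refine ((h₁.add h₂).add h₃).congr_left fun ε => ?_
  simp only [map_add, map_sub, map_smul, add_apply,
    sub_apply, smul_apply]
  module

theorem smul {g : ℝ → ℝ} {p q r : ℝ} (hg : HasQuadExpansion g p q r)
    (h : HasQuadExpansion f a b c) :
    HasQuadExpansion (fun ε => g ε • f ε) (p • a) (p • b + q • a) (p • c + q • b + r • a) :=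
  bilin (ContinuousLinearMap.lsmul ℝ ℝ) hg h

end NormedSpace

section Real

variable {f g : ℝ → ℝ} {a b c p q r : ℝ}

theorem mul (h : HasQuadExpansion f a b c) (hg : HasQuadExpansion g p q r) :
    HasQuadExpansion (fun ε => f ε * g ε) (a * p) (a * q + b * p) (a * r + b * q + c * p) :=
  smul h hg

theorem inv (h : HasQuadExpansion f a 0 c) (ha : a ≠ 0) :
    HasQuadExpansion (fun ε => (f ε)⁻¹) a⁻¹ 0 (-c / a ^ 2) := by
  have hr : HasQuadExpansion (fun ε => a⁻¹ + ε • (0 : ℝ) + ε ^ 2 • (-c / a ^ 2))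
      a⁻¹ 0 (-c / a ^ 2) := by
    simpa [HasQuadExpansion] using isBigO_zero _ _
  have h₁ : (fun ε => 1 - f ε * (a⁻¹ + ε • (0 : ℝ) + ε ^ 2 • (-c / a ^ 2)))
      =O[𝓝[≠] (0 : ℝ)] fun ε => ε ^ 3 := by
    refine IsBigO.congr_left ((const (1 : ℝ)).sub (h.mul hr)) fun ε => ?_
    simp only [smul_eq_mul]
    field_simp
    ring
  have h₂ := ((h.tendsto.inv₀ ha).isBigO_one ℝ).mul h₁
  simp only [one_mul] at h₂
  refine h₂.congr' ?_ .rfl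
  filter_upwards [h.tendsto.eventually_ne ha] with ε hε
  rw [mul_sub, inv_mul_cancel_left₀ hε, mul_one]

theorem div (h : HasQuadExpansion f a 0 c) (hg : HasQuadExpansion g p 0 r) (hp : p ≠ 0) :
    HasQuadExpansion (fun ε => f ε / g ε) (a / p) 0 (c / p - a * r / p ^ 2) := by
  simp only [div_eq_mul_inv (f _)]
  convert h.mul (hg.inv hp) using 1
  all_goals ring

theorem of_sq (h : HasQuadExpansion (fun ε => f ε ^ 2) (a ^ 2) 0 (2 * a * c)) (ha : 0 < a)
    (hf : ∀ ε, 0 ≤ f ε) : HasQuadExpansion f a 0 c := by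
  have hr : HasQuadExpansion (fun ε => a + ε • (0 : ℝ) + ε ^ 2 • c) a 0 c := by
    simpa [HasQuadExpansion] using isBigO_zero _ _
  have hlim : Filter.Tendsto f (𝓝[≠] 0) (𝓝 a) := by
    simpa [Real.sqrt_sq ha.le, Real.sqrt_sq (hf _)] using h.tendsto.sqrt
  have h₁ : (fun ε => f ε ^ 2 - (a + ε • (0 : ℝ) + ε ^ 2 • c) ^ 2)
      =O[𝓝[≠] (0 : ℝ)] fun ε => ε ^ 3 := by
    refine IsBigO.congr_left (h.sub (hr.mul hr)) fun ε => ?_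
    simp only [smul_eq_mul]
    ring
  have hsum := hlim.add hr.tendsto
  have h₂ := ((hsum.inv₀ (by positivity)).isBigO_one ℝ).mul h₁
  simp only [one_mul] at h₂
  refine h₂.congr' ?_ .rfl
  filter_upwards [hsum.eventually_ne (by positivity)] with ε hε
  rw [sq_sub_sq, inv_mul_cancel_left₀ hε]

end Real

theorem norm {E : Type*} [NormedAddCommGroup E] [InnerProductSpace ℝ E] {f : ℝ → E} {a b c : E}
    {p r : ℝ} (h : HasQuadExpansion f a b c) (hp : 0 < p) (haa : ⟪a, a⟫ = p ^ 2)
    (hab : ⟪a, b⟫ = 0) (hac : 2 * ⟪a, c⟫ + ⟪b, b⟫ = 2 * p * r) :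
    HasQuadExpansion (fun ε => ‖f ε‖) p 0 r := by
  refine of_sq ?_ hp fun ε => norm_nonneg _
  have h₁ : HasQuadExpansion (fun ε => ⟪f ε, f ε⟫) ⟪a, a⟫ (⟪a, b⟫ + ⟪b, a⟫)
      (⟪a, c⟫ + ⟪b, b⟫ + ⟪c, a⟫) := bilin (innerSL ℝ) h h
  simp only [real_inner_self_eq_norm_sq (f _)] at h₁
  convert h₁ using 1
  · exact haa.symm
  · rw [real_inner_comm a b, hab, add_zero]
  · rw [← hac, real_inner_comm a c]
    ring

end HasQuadExpansion

/-- The rescaled chords of a smooth curve at a point have the expansion given by Taylor's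
formula. -/
theorem hasQuadExpansion_chord {E : Type*} [NormedAddCommGroup E] [NormedSpace ℝ E] {x : ℝ → E}
    (hx : ContDiff ℝ 4 x) (s k : ℝ) :
    HasQuadExpansion (fun ε => ε⁻¹ • (x (s + k * ε) - x s)) (k • deriv x s)
      ((k ^ 2 / 2) • iteratedDeriv 2 x s) ((k ^ 3 / 6) • iteratedDeriv 3 x s) := by
  have h₁ := (taylor_isLittleO_univ (x₀ := s) (n := 4) hx).isBigO
  have hk : Filter.Tendsto (fun ε : ℝ => s + k * ε) (𝓝[≠] 0) (𝓝 s) := by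
    have h : Continuous fun ε : ℝ => s + k * ε := by fun_prop
    simpa using (h.tendsto 0).mono_left nhdsWithin_le_nhds
  have h₂ := h₁.comp_tendsto hk
  have h₃ : (fun ε : ℝ => ε⁻¹ • (x (s + k * ε) - taylorWithinEval x 4 Set.univ s (s + k * ε)))
      =O[𝓝[≠] (0 : ℝ)] fun ε => ε ^ 3 := by
    have h₄ : (fun ε : ℝ => (s + k * ε - s) ^ 4) =O[𝓝[≠] (0 : ℝ)] fun ε => ε ^ 4 := by
      refine (isBigO_const_mul_self (k ^ 4) (fun ε : ℝ => ε ^ 4) _).congr_left fun ε => ?_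
      ring
    refine ((isBigO_refl (fun ε : ℝ => ε⁻¹) (𝓝[≠] 0)).smul (h₂.trans h₄)).congr' .rfl ?_
    filter_upwards [self_mem_nhdsWithin] with ε hε
    have hε : ε ≠ 0 := hε
    simp only [smul_eq_mul]
    field_simp
  have h₅ : (fun ε : ℝ => ε ^ 3 • ((k ^ 4 / 24) • iteratedDeriv 4 x s)) =O[𝓝[≠] (0 : ℝ)]
      fun ε => ε ^ 3 := by
    simpa using (isBigO_refl (fun ε : ℝ => ε ^ 3) (𝓝[≠] 0)).smul
      (isBigO_const_const ((k ^ 4 / 24) • iteratedDeriv 4 x s) (one_ne_zero (α := ℝ)) _)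
  refine (h₃.add h₅).congr' ?_ .rfl
  filter_upwards [self_mem_nhdsWithin] with ε hε
  have hε : ε ≠ 0 := hε
  simp only [taylorWithinEval_succ, taylor_within_zero_eval, iteratedDerivWithin_univ,
    add_sub_cancel_left, zero_add, iteratedDeriv_one]
  norm_num [Nat.factorial]
  match_scalars <;> field_simp
  ring

theorem tMid_smul {ε : ℝ} (hε : ε ≠ 0) (o a m b : E3) :
    tMid (o + ε • a) (o + ε • m) (o + ε • b) = (ε / |ε|) • tMid a m b := by
  have hε' : |ε| ≠ 0 := abs_ne_zero.2 hε
  have hd (u v : E3) : dist (o + ε • u) (o + ε • v) = |ε| * dist u v := by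
    rw [dist_add_left, dist_smul₀, Real.norm_eq_abs]
  simp only [tMid, hd, mul_div_mul_left _ _ hε', add_sub_add_left_eq_sub, ← smul_sub]
  module

theorem tLast_smul {ε : ℝ} (hε : ε ≠ 0) (o a m b : E3) :
    tLast (o + ε • a) (o + ε • m) (o + ε • b) = (ε / |ε|) • tLast a m b := by
  have hε' : |ε| ≠ 0 := abs_ne_zero.2 hε
  have hd (u v : E3) : dist (o + ε • u) (o + ε • v) = |ε| * dist u v := by
    rw [dist_add_left, dist_smul₀, Real.norm_eq_abs]
  simp only [tLast, hd, mul_div_mul_left _ _ hε', add_sub_add_left_eq_sub, ← smul_sub]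
  module

theorem norm_sq_tMid {a m b : E3} (ham : a ≠ m) (hmb : m ≠ b) (hab : a ≠ b) :
    ‖tMid a m b‖ ^ 2 = 1 := by
  have hp := dist_ne_zero.2 ham
  have hq := dist_ne_zero.2 hmb
  have hr := dist_ne_zero.2 hab
  have h : dist a b ^ 2 = dist m b ^ 2 + 2 * ⟪b - m, m - a⟫ + dist a m ^ 2 := by
    rw [dist_comm a b, dist_comm m b, dist_comm a m, dist_eq_norm, dist_eq_norm, dist_eq_norm,
      ← norm_add_sq_real, sub_add_sub_cancel]
  have hb : ‖b - m‖ = dist m b := by rw [dist_comm, dist_eq_norm]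
  have ha : ‖m - a‖ = dist a m := by rw [dist_comm, dist_eq_norm]
  rw [tMid, norm_smul, mul_pow, norm_add_sq_real, norm_smul, norm_smul, inner_smul_left,
    inner_smul_right, hb, ha]
  simp only [Real.norm_eq_abs, mul_pow, sq_abs, conj_trivial]
  field_simp
  linarith

theorem norm_sq_tLast {a m b : E3} (ham : a ≠ m) (hmb : m ≠ b) (hab : a ≠ b) :
    ‖tLast a m b‖ ^ 2 = 1 := by
  have hp := dist_ne_zero.2 ham
  have hq := dist_ne_zero.2 hmb
  have hr := dist_ne_zero.2 hab
  have h : dist a m ^ 2 = dist a b ^ 2 + 2 * ⟪a - b, b - m⟫ + dist m b ^ 2 := by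
    rw [dist_comm m b, dist_eq_norm, dist_eq_norm, dist_eq_norm,
      ← norm_add_sq_real, sub_add_sub_cancel]
  have hb : ‖b - m‖ = dist m b := by rw [dist_comm, dist_eq_norm]
  have ha : ‖a - b‖ = dist a b := by rw [dist_eq_norm]
  rw [tLast, norm_smul, mul_pow, norm_add_sq_real, norm_smul, norm_smul, inner_smul_left,
    inner_smul_right, hb, ha]
  simp only [Real.norm_eq_abs, mul_pow, sq_abs, conj_trivial]
  field_simp
  linarith

/-- The Gram determinant identity for the triple product `⟪u × v, w⟫` with `u ⟂ v`. -/
theorem inner_cross3_sq {u v : E3} (huv : ⟪u, v⟫ = 0) (w : E3) :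
    ⟪cross3 u v, w⟫ ^ 2 =
      ⟪u, u⟫ * ⟪v, v⟫ * ⟪w, w⟫ - ⟪u, u⟫ * ⟪v, w⟫ ^ 2 - ⟪v, v⟫ * ⟪u, w⟫ ^ 2 := by
  have h : ⟪cross3 u v, w⟫ ^ 2 =
      ⟪u, u⟫ * ⟪v, v⟫ * ⟪w, w⟫ - ⟪u, u⟫ * ⟪v, w⟫ ^ 2 - ⟪v, v⟫ * ⟪u, w⟫ ^ 2
        + ⟪u, v⟫ * (2 * ⟪u, w⟫ * ⟪v, w⟫ - ⟪u, v⟫ * ⟪w, w⟫) := by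
    simp only [PiLp.inner_apply, Fin.sum_univ_three]
    simp [cross3]
    ring
  rw [h, huv]
  ring

theorem hasDerivAt_iteratedDeriv {E : Type*} [NormedAddCommGroup E] [NormedSpace ℝ E]
    {x : ℝ → E} (hx : ContDiff ℝ (⊤ : ℕ∞) x) (n : ℕ) (s : ℝ) :
    HasDerivAt (iteratedDeriv n x) (iteratedDeriv (n + 1) x s) s := by
  rw [iteratedDeriv_succ]
  exact (hx.differentiable_iteratedDeriv n (by exact_mod_cast WithTop.coe_lt_top _) s).hasDerivAt

section Arclength

variable {x : ℝ → E3}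

theorem inner_deriv_iteratedDeriv_two (hx : ContDiff ℝ (⊤ : ℕ∞) x)
    (harc : ∀ s, ‖deriv x s‖ = 1) (s : ℝ) : ⟪deriv x s, iteratedDeriv 2 x s⟫ = 0 := by
  have h := (hasDerivAt_iteratedDeriv hx 1 s).norm_sq
  simp only [iteratedDeriv_one, harc] at h
  simpa using h.unique (hasDerivAt_const s _)

theorem inner_deriv_iteratedDeriv_three (hx : ContDiff ℝ (⊤ : ℕ∞) x)
    (harc : ∀ s, ‖deriv x s‖ = 1) (s : ℝ) :
    ⟪deriv x s, iteratedDeriv 3 x s⟫ = -⟪iteratedDeriv 2 x s, iteratedDeriv 2 x s⟫ := by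
  have h := (hasDerivAt_iteratedDeriv hx 1 s).inner ℝ (hasDerivAt_iteratedDeriv hx 2 s)
  simp only [iteratedDeriv_one, inner_deriv_iteratedDeriv_two hx harc] at h
  exact eq_neg_of_add_eq_zero_left (h.unique (hasDerivAt_const s _))

theorem curv_mul_deriv_curv (hx : ContDiff ℝ (⊤ : ℕ∞) x) {s : ℝ} (hs : 0 < curv x s) :
    curv x s * deriv (curv x) s = ⟪iteratedDeriv 2 x s, iteratedDeriv 3 x s⟫ := by
  have hA := hasDerivAt_iteratedDeriv hx 2 s
  have hd : DifferentiableAt ℝ (curv x) s :=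
    hA.differentiableAt.norm ℝ (norm_pos_iff.1 hs)
  have h := (hd.hasDerivAt.pow 2).unique hA.norm_sq
  norm_num at h
  linarith

/-- The squared norm of the normal component of the third derivative. -/
theorem inner_iteratedDeriv_three_self (hx : ContDiff ℝ (⊤ : ℕ∞) x)
    (harc : ∀ s, ‖deriv x s‖ = 1) {s : ℝ} (hs : 0 < curv x s) :
    ⟪iteratedDeriv 3 x s, iteratedDeriv 3 x s⟫ - curv x s ^ 4 =
      curv x s ^ 2 * tors x s ^ 2 + deriv (curv x) s ^ 2 := by
  have hκ : ⟪iteratedDeriv 2 x s, iteratedDeriv 2 x s⟫ = curv x s ^ 2 :=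
    real_inner_self_eq_norm_sq _
  have ht : ⟪deriv x s, deriv x s⟫ = 1 := by rw [real_inner_self_eq_norm_sq, harc, one_pow]
  have h := inner_cross3_sq (inner_deriv_iteratedDeriv_two hx harc s) (iteratedDeriv 3 x s)
  rw [inner_deriv_iteratedDeriv_three hx harc, hκ, ht, ← curv_mul_deriv_curv hx hs] at h
  have hne := hs.ne'
  rw [tors, div_pow, h]
  field_simp
  ring

end Arclength

/-- If two unit vectors differ by `ε² w + O(ε³)`, their inner product is
`1 - ε⁴ ‖w‖² / 2 + O(ε⁵)`. -/
theorem isBigO_inner_of_hasQuadExpansion_sub {E : Type*} [NormedAddCommGroup E]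
    [InnerProductSpace ℝ E] {f g : ℝ → E} {w : E}
    (h : HasQuadExpansion (fun ε => f ε - g ε) 0 0 w)
    (hf : ∀ᶠ ε in 𝓝[≠] (0 : ℝ), ‖f ε‖ ^ 2 = 1) (hg : ∀ᶠ ε in 𝓝[≠] (0 : ℝ), ‖g ε‖ ^ 2 = 1) :
    (fun ε => ⟪f ε, g ε⟫ - (1 - 1 / 2 * ⟪w, w⟫ * ε ^ 4)) =O[𝓝[≠] (0 : ℝ)] fun ε => ε ^ 5 := by
  have h₁ : (fun ε => f ε - g ε - ε ^ 2 • w) =O[𝓝[≠] (0 : ℝ)] fun ε => ε ^ 3 := by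
    simpa [HasQuadExpansion] using h
  have h₂ : (fun ε : ℝ => ε ^ 2 • w) =O[𝓝[≠] (0 : ℝ)] fun ε => ε ^ 2 := by
    simpa using (isBigO_refl (fun ε : ℝ => ε ^ 2) (𝓝[≠] 0)).smul
      (isBigO_const_const w (one_ne_zero (α := ℝ)) _)
  have h₃ : (fun ε : ℝ => ε ^ 3) =O[𝓝[≠] (0 : ℝ)] fun ε => ε ^ 2 :=
    (isLittleO_pow_pow (by norm_num)).isBigO.mono nhdsWithin_le_nhds
  have h₄ := (h₁.trans h₃).add (h₂.add h₂)
  have h₅ := ((isBoundedBilinearMap_inner (𝕜 := ℝ) (E := E)).isBigO_comp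
    (g := fun ε => f ε - g ε - ε ^ 2 • w)
    (h := fun ε => f ε - g ε - ε ^ 2 • w + (ε ^ 2 • w + ε ^ 2 • w))).trans
    (h₁.norm_left.mul h₄.norm_left)
  refine (h₅.const_mul_left (-1 / 2)).congr' ?_ (.of_eq (funext fun ε => by ring))
  filter_upwards [hf, hg] with ε hf hg
  rw [← real_inner_self_eq_norm_sq] at hf hg
  simp only [inner_sub_left, inner_add_right, inner_sub_right, inner_smul_left, inner_smul_right,
    conj_trivial, hf, hg, real_inner_comm (f ε) (g ε), real_inner_comm w (f ε),
    real_inner_comm w (g ε)]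
  ring

theorem statement3 (x : ℝ → E3) (hx : ContDiff ℝ (⊤ : ℕ∞) x)
    (harc : ∀ s, ‖deriv x s‖ = 1) (s₀ : ℝ)
    (hκ : ∀ᶠ s in 𝓝 s₀, 0 < curv x s) :
    (fun ε : ℝ =>
        ⟪tLast (x (s₀ - 2 * ε)) (x (s₀ - ε)) (x s₀),
            tMid (x (s₀ - ε)) (x s₀) (x (s₀ + ε))⟫ -
          (1 - 1 / 8 * (curv x s₀ ^ 2 * tors x s₀ ^ 2 + deriv (curv x) s₀ ^ 2) * ε ^ 4))
      =O[𝓝[≠] (0 : ℝ)] fun ε => ε ^ 5 := by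
  set t := deriv x s₀
  set A := iteratedDeriv 2 x s₀
  set B := iteratedDeriv 3 x s₀
  set κ := curv x s₀
  have hκ₀ : 0 < κ := hκ.self_of_nhds
  have htt : ⟪t, t⟫ = 1 := by rw [real_inner_self_eq_norm_sq, harc, one_pow]
  have htA : ⟪t, A⟫ = 0 := inner_deriv_iteratedDeriv_two hx harc s₀
  have hAA : ⟪A, A⟫ = κ ^ 2 := real_inner_self_eq_norm_sq _
  have htB : ⟪t, B⟫ = -κ ^ 2 := by rw [← hAA]; exact inner_deriv_iteratedDeriv_three hx harc s₀
  let y (k ε : ℝ) : E3 := ε⁻¹ • (x (s₀ + k * ε) - x s₀)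
  have hy (k : ℝ) : HasQuadExpansion (y k) (k • t) ((k ^ 2 / 2) • A) ((k ^ 3 / 6) • B) :=
    hasQuadExpansion_chord (hx.of_le ENat.LEInfty.out) s₀ k
  have hd (j k p : ℝ) (hp : 0 < p) (hjk : (j - k) ^ 2 = p ^ 2) :
      HasQuadExpansion (fun ε => dist (y j ε) (y k ε)) p 0 (-κ ^ 2 / 24 * p ^ 3) := by
    simp only [dist_eq_norm]
    refine ((hy j).sub (hy k)).norm hp ?_ ?_ ?_
    · rw [← sub_smul, inner_smul_left, inner_smul_right, htt, ← hjk, conj_trivial]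
      ring
    · rw [← sub_smul, ← sub_smul, inner_smul_left, inner_smul_right, htA]
      simp
    · rw [← sub_smul, ← sub_smul, ← sub_smul, inner_smul_left, inner_smul_right, inner_smul_left,
        inner_smul_right, htB, hAA]
      simp only [conj_trivial]
      linear_combination (-κ ^ 2 / 12 * ((j - k) ^ 2 + p ^ 2)) * hjk
  have hlast : HasQuadExpansion (fun ε => tLast (y (-2) ε) (y (-1) ε) (y 0 ε)) t 0
      (-(1 / 3 : ℝ) • (B + κ ^ 2 • t)) := by
    have hp := hd (-2) (-1) 1 one_pos (by norm_num)
    have hq := hd (-1) 0 1 one_pos (by norm_num)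
    have hr := hd (-2) 0 2 two_pos (by norm_num)
    convert ((HasQuadExpansion.const 1).div hp one_ne_zero).smul
      (((hq.div hr two_ne_zero).smul ((hy (-2)).sub (hy 0))).add
        ((hr.div hq one_ne_zero).smul ((hy 0).sub (hy (-1))))) using 1
    · rfl
    all_goals module
  have hmid : HasQuadExpansion (fun ε => tMid (y (-1) ε) (y 0 ε) (y 1 ε)) t 0
      ((1 / 6 : ℝ) • (B + κ ^ 2 • t)) := by
    have hp := hd (-1) 0 1 one_pos (by norm_num)
    have hq := hd 0 1 1 one_pos (by norm_num)
    have hr := hd (-1) 1 2 two_pos (by norm_num)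
    convert ((HasQuadExpansion.const 1).div hr two_ne_zero).smul
      (((hp.div hq one_ne_zero).smul ((hy 1).sub (hy 0))).add
        ((hq.div hp one_ne_zero).smul ((hy 0).sub (hy (-1))))) using 1
    · rfl
    all_goals module
  have hne (j k p : ℝ) (hp : 0 < p) (hjk : (j - k) ^ 2 = p ^ 2) :
      ∀ᶠ ε in 𝓝[≠] (0 : ℝ), y j ε ≠ y k ε := by
    filter_upwards [(hd j k p hp hjk).tendsto.eventually_ne hp.ne'] with ε hε
    exact dist_ne_zero.1 hε
  have hsub : HasQuadExpansion (fun ε => tLast (y (-2) ε) (y (-1) ε) (y 0 ε) -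
      tMid (y (-1) ε) (y 0 ε) (y 1 ε)) 0 0 (-(1 / 2 : ℝ) • (B + κ ^ 2 • t)) := by
    convert hlast.sub hmid using 1
    all_goals module
  have key := isBigO_inner_of_hasQuadExpansion_sub hsub
    (by
      filter_upwards [hne (-2) (-1) 1 one_pos (by norm_num), hne (-1) 0 1 one_pos (by norm_num),
        hne (-2) 0 2 two_pos (by norm_num)] with ε h₁ h₂ h₃ using norm_sq_tLast h₁ h₂ h₃)
    (by
      filter_upwards [hne (-1) 0 1 one_pos (by norm_num), hne 0 1 1 one_pos (by norm_num),
        hne (-1) 1 2 two_pos (by norm_num)] with ε h₁ h₂ h₃ using norm_sq_tMid h₁ h₂ h₃)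
  have hw : ⟪-(1 / 2 : ℝ) • (B + κ ^ 2 • t), -(1 / 2 : ℝ) • (B + κ ^ 2 • t)⟫ =
      1 / 4 * (κ ^ 2 * tors x s₀ ^ 2 + deriv (curv x) s₀ ^ 2) := by
    rw [← inner_iteratedDeriv_three_self hx harc hκ₀]
    simp only [inner_smul_left, inner_smul_right, inner_add_left, inner_add_right, conj_trivial,
      real_inner_comm t B, htB, htt]
    ring
  rw [hw] at key
  refine key.congr' ?_ .rfl
  filter_upwards [self_mem_nhdsWithin] with ε hε
  have hε : ε ≠ 0 := hε
  have hxy (k : ℝ) : x (s₀ + k * ε) = x s₀ + ε • y k ε := by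
    simp [y, smul_smul, hε]
  have e₁ : x (s₀ - 2 * ε) = x s₀ + ε • y (-2) ε := by rw [← hxy]; congr 1; ring
  have e₂ : x (s₀ - ε) = x s₀ + ε • y (-1) ε := by rw [← hxy]; congr 1; ring
  have e₃ : x s₀ = x s₀ + ε • y 0 ε := by rw [← hxy]; congr 1; ring
  have e₄ : x (s₀ + ε) = x s₀ + ε • y 1 ε := by rw [← hxy]; congr 1; ring
  have hσ : ε / |ε| * (ε / |ε|) = 1 := by
    rw [div_mul_div_comm, abs_mul_abs_self, div_self (mul_ne_zero hε hε)]
  have hL : tLast (x (s₀ - 2 * ε)) (x (s₀ - ε)) (x s₀) =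
      (ε / |ε|) • tLast (y (-2) ε) (y (-1) ε) (y 0 ε) := by
    rw [← tLast_smul hε (x s₀), ← e₁, ← e₂, ← e₃]
  have hM : tMid (x (s₀ - ε)) (x s₀) (x (s₀ + ε)) =
      (ε / |ε|) • tMid (y (-1) ε) (y 0 ε) (y 1 ε) := by
    rw [← tMid_smul hε (x s₀), ← e₂, ← e₃, ← e₄]
  rw [hL, hM, inner_smul_left, inner_smul_right, conj_trivial, ← mul_assoc (ε / |ε|), hσ]
  ring
end
end

section
/- For five pairwise distinct points x₁, …, x₅ ∈ ℝ³, writing x_{ij} = |x_i − x_j|, one has tLast(x₁,x₂,x₃) · tFirst(x₃,x₄,x₅) = (x₁₃²·x₂₄²·x₃₅² + x₁₅²·x₂₃²·x₃₄² − x₁₃²·x₂₅²·x₃₄² − x₁₄²·x₂₃²·x₃₅²) / (2·x₁₂·x₁₃·x₂₃·x₃₄·x₃₅·x₄₅), i.e. the cosine of the torsion angle at x₃ between the circumcircle of (x₁,x₂,x₃) and the circumcircle of (x₃,x₄,x₅) is given by this distance formula. -/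
open scoped RealInnerProductSpace Topology

noncomputable section

/-- Polarization: the inner product of two edges at `c` in terms of distances. -/
theorem inner_sub_sub_eq_dist {V : Type*} [NormedAddCommGroup V] [InnerProductSpace ℝ V]
    (p q c : V) :
    ⟪p - c, q - c⟫ = (dist p c ^ 2 + dist c q ^ 2 - dist p q ^ 2) / 2 := by
  have h := norm_sub_sq_real (p - c) (q - c)
  rw [sub_sub_sub_cancel_right] at h
  rw [dist_comm c q, dist_eq_norm, dist_eq_norm, dist_eq_norm]
  linarith

theorem statement7 (x₁ x₂ x₃ x₄ x₅ : E3)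
    (h12 : x₁ ≠ x₂) (h13 : x₁ ≠ x₃) (h14 : x₁ ≠ x₄) (h15 : x₁ ≠ x₅)
    (h23 : x₂ ≠ x₃) (h24 : x₂ ≠ x₄) (h25 : x₂ ≠ x₅)
    (h34 : x₃ ≠ x₄) (h35 : x₃ ≠ x₅) (h45 : x₄ ≠ x₅) :
    ⟪tLast x₁ x₂ x₃, tFirst x₃ x₄ x₅⟫ =
      (dist x₁ x₃ ^ 2 * dist x₂ x₄ ^ 2 * dist x₃ x₅ ^ 2 +
          dist x₁ x₅ ^ 2 * dist x₂ x₃ ^ 2 * dist x₃ x₄ ^ 2 -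
          dist x₁ x₃ ^ 2 * dist x₂ x₅ ^ 2 * dist x₃ x₄ ^ 2 -
          dist x₁ x₄ ^ 2 * dist x₂ x₃ ^ 2 * dist x₃ x₅ ^ 2) /
        (2 * dist x₁ x₂ * dist x₁ x₃ * dist x₂ x₃ * dist x₃ x₄ * dist x₃ x₅ *
          dist x₄ x₅) := by
  have d13 := dist_ne_zero.2 h13
  have d23 := dist_ne_zero.2 h23
  have d34 := dist_ne_zero.2 h34
  have d35 := dist_ne_zero.2 h35
  rw [tLast, tFirst, ← neg_sub x₂ x₃, ← neg_sub x₅ x₃]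
  simp only [inner_add_left, inner_add_right, real_inner_smul_left, real_inner_smul_right,
    inner_neg_left, inner_neg_right, inner_sub_sub_eq_dist]
  field_simp
  ring
end
end
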